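/- Let P^(d), Q^(d) be independent points in [0,1]^d with i.i.d. uniform coordinates. Then lim_{d→∞} Var[‖P^(d) - Q^(d)‖₂] = (7/180)/(4 · (1/6)) = 7/120. -/

import Mathlib

open MeasureTheory ProbabilityTheory Filter

/-- The uniform probability measure on the unit cube `[0,1]^d`. -/
noncomputable def unifCube (d : ℕ) : Measure (EuclideanSpace ℝ (Fin d)) :=
  volume.restrict {x | ∀ i, x i ∈ Set.Icc (0 : ℝ) 1}

noncomputable def lam : Measure ℝ := volume.restrict (Set.Icc (0:ℝ) 1)

instance : IsProbabilityMeasure lam := ⟨by simp [lam]⟩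

lemma lam_int (f : ℝ → ℝ) : ∫ x, f x ∂lam = ∫ x in (0:ℝ)..1, f x := by
  rw [lam, integral_Icc_eq_integral_Ioc, intervalIntegral.integral_of_le zero_le_one]

lemma lam_mem : ∀ᵐ x ∂lam, x ∈ Set.Icc (0:ℝ) 1 := ae_restrict_mem measurableSet_Icc

lemma lam2_mem : ∀ᵐ x ∂(lam.prod lam), x.1 ∈ Set.Icc (0:ℝ) 1 ∧ x.2 ∈ Set.Icc (0:ℝ) 1 := by
  have h1 := (Measure.quasiMeasurePreserving_fst (μ := lam) (ν := lam)).ae lam_mem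
  have h2 := (Measure.quasiMeasurePreserving_snd (μ := lam) (ν := lam)).ae lam_mem
  filter_upwards [h1, h2] with x h h' using ⟨h, h'⟩

noncomputable def yy (x : ℝ × ℝ) : ℝ := (x.1 - x.2)^2 - 1/6

lemma yy_cont : Continuous yy := by unfold yy; fun_prop

lemma yy_bd : ∀ᵐ x ∂(lam.prod lam), |yy x| ≤ 1 := by
  filter_upwards [lam2_mem] with x hx
  obtain ⟨⟨a, b⟩, c, d⟩ := hx
  rw [abs_le]; unfold yy; constructor <;> nlinarith

lemma yy_int (n : ℕ) : Integrable (fun x => yy x ^ n) (lam.prod lam) := by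
  refine Integrable.of_bound (C := 1) (yy_cont.pow n).aestronglyMeasurable ?_
  filter_upwards [yy_bd] with x hx
  rw [Real.norm_eq_abs, abs_pow]
  exact pow_le_one₀ (abs_nonneg _) hx

lemma yy_mean : ∫ x, yy x ∂(lam.prod lam) = 0 := by
  rw [integral_prod _ (by simpa using yy_int 1)]
  simp only [lam_int, yy]
  have : ∀ x : ℝ, ∫ y in (0:ℝ)..1, ((x - y)^2 - 1/6) = x^2 - x + 1/6 := by
    intro x
    have e : ∀ y : ℝ, (x-y)^2 - 1/6 = (x^2-1/6) - 2 * x * y + y^2 := fun y => by ring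
    simp only [e]
    rw [intervalIntegral.integral_add (Continuous.intervalIntegrable (by fun_prop) _ _) (Continuous.intervalIntegrable (by fun_prop) _ _), intervalIntegral.integral_sub (Continuous.intervalIntegrable (by fun_prop) _ _) (Continuous.intervalIntegrable (by fun_prop) _ _), intervalIntegral.integral_const_mul]
    simp
    ring
  simp only [this]
  rw [intervalIntegral.integral_add (Continuous.intervalIntegrable (by fun_prop) _ _) (Continuous.intervalIntegrable (by fun_prop) _ _), intervalIntegral.integral_sub (Continuous.intervalIntegrable (by fun_prop) _ _) (Continuous.intervalIntegrable (by fun_prop) _ _)]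
  simp
  norm_num

lemma yy_var : ∫ x, yy x ^ 2 ∂(lam.prod lam) = 7/180 := by
  rw [integral_prod _ (yy_int 2)]
  simp only [lam_int, yy]
  have ii : ∀ f : ℝ → ℝ, Continuous f → IntervalIntegrable f volume 0 1 := fun f hf => hf.intervalIntegrable _ _
  have poly : ∀ a b c d e : ℝ, ∫ y in (0:ℝ)..1, (a + b * y + c * y^2 + d * y^3 + e * y^4) = a + b/2+c/3+d/4+e/5 := by
    intro a b c d e
    rw [intervalIntegral.integral_add (ii _ (by fun_prop)) (ii _ (by fun_prop)),
      intervalIntegral.integral_add (ii _ (by fun_prop)) (ii _ (by fun_prop)),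
      intervalIntegral.integral_add (ii _ (by fun_prop)) (ii _ (by fun_prop)),
      intervalIntegral.integral_add (ii _ (by fun_prop)) (ii _ (by fun_prop))]
    simp only [intervalIntegral.integral_const_mul, integral_pow, intervalIntegral.integral_const]
    have i1 : ∫ x in (0:ℝ)..1, x = 1/2 := by simp
    have i2 : ∫ x in (0:ℝ)..1, b * x = b * (1/2) := by rw [intervalIntegral.integral_const_mul, i1]
    rw [i2]
    norm_num
    ring
  have e : ∀ x y : ℝ, ((x-y)^2 - 1/6)^2 = (x^2-1/6)^2 + (-4*x*(x^2-1/6)) * y + (4*x^2+2*(x^2-1/6)) * y^2 + (-4*x) * y^3 + 1 * y^4 := fun x y => by ring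
  simp only [e, poly]
  have e2 : ∀ x : ℝ, (x^2-1/6)^2 + (-4*x*(x^2-1/6))/2 + (4*x^2+2*(x^2-1/6))/3 + (-4*x)/4 + 1/5 = (1/36-1/9+1/5) + (1/3 - 1) * x + (-1/3+2) * x^2 + (-2) * x^3 + 1 * x^4 := fun x => by ring
  simp only [e2, poly]
  norm_num

lemma unif_eq (d : ℕ) : unifCube d = Measure.map (WithLp.toLp 2) (Measure.pi (fun _ : Fin d => lam)) := by
  have h := (PiLp.volume_preserving_toLp (Fin d)).map_eq
  rw [unifCube, ← h]
  have hm : MeasurableSet {x : EuclideanSpace ℝ (Fin d) | ∀ i, x i ∈ Set.Icc (0 : ℝ) 1} := by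
    rw [Set.ofPred_forall]
    refine MeasurableSet.iInter fun i => ?_
    exact measurableSet_Icc.preimage (by fun_prop)
  rw [Measure.restrict_map (by fun_prop) hm]
  congr 1
  have : lam = volume.restrict (Set.Icc (0:ℝ) 1) := rfl
  rw [this, ← Measure.restrict_pi_pi, volume_pi]
  congr 1
  ext x; simp [Pi.le_def, forall_and]


lemma bint {Ω : Type*} [MeasurableSpace Ω] {μ : Measure Ω} [IsProbabilityMeasure μ]
    {f : Ω → ℝ} (C : ℝ) (hf : Measurable f) (hb : ∀ᵐ x ∂μ, |f x| ≤ C) : Integrable f μ :=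
  Integrable.of_bound (C := C) hf.aestronglyMeasurable (by simpa using hb)

lemma moments {Ω ι : Type*} [MeasurableSpace Ω] {μ : Measure Ω} [IsProbabilityMeasure μ]
    (Y : ι → Ω → ℝ) (hY : iIndepFun Y μ) (hm : ∀ i, Measurable (Y i))
    (hb : ∀ i, ∀ᵐ x ∂μ, |Y i x| ≤ 1) (h1 : ∀ i, ∫ x, Y i x ∂μ = 0) (v : ℝ) (hv : v ≤ 1) (hv0 : 0 ≤ v)
    (h2 : ∀ i, ∫ x, Y i x ^ 2 ∂μ = v) (s : Finset ι) :
    (∀ᵐ x ∂μ, |∑ i ∈ s, Y i x| ≤ s.card) ∧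
    ∫ x, (∑ i ∈ s, Y i x) ∂μ = 0 ∧ ∫ x, (∑ i ∈ s, Y i x) ^ 2 ∂μ = s.card * v ∧
    ∫ x, (∑ i ∈ s, Y i x) ^ 4 ∂μ ≤ 3 * (s.card : ℝ) ^ 2 := by
  classical
  induction s using Finset.induction_on with
  | empty => simp
  | insert i s hi ih =>
    obtain ⟨b, m1, m2, m4⟩ := ih
    have ind : IndepFun (fun x => ∑ j ∈ s, Y j x) (Y i) μ := by
      have := hY.indepFun_finsetSum_of_notMem hm hi
      convert this using 1
      ext x; simp
    simp only [Finset.sum_insert hi, Finset.card_insert_of_notMem hi]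
    set T : Ω → ℝ := fun x => ∑ j ∈ s, Y j x with hT
    have Tm : Measurable T := by fun_prop
    have ig : ∀ p q : ℕ, Integrable (fun x => T x ^ p * Y i x ^ q) μ := by
      intro p q
      refine bint ((s.card : ℝ) ^ p * 1 ^ q) (by have := hm i; fun_prop) ?_
      filter_upwards [b, hb i] with x hx hx'
      rw [abs_mul, abs_pow, abs_pow]
      gcongr
    have pr : ∀ p q : ℕ, ∫ x, T x ^ p * Y i x ^ q ∂μ = (∫ x, T x ^ p ∂μ) * ∫ x, Y i x ^ q ∂μ := by
      intro p q
      have := ind.comp (φ := fun t => t ^ p) (ψ := fun t => t ^ q) (by fun_prop) (by fun_prop)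
      exact this.integral_fun_mul_eq_mul_integral (Tm.pow_const p).aestronglyMeasurable ((hm i).pow_const q).aestronglyMeasurable
    change (∀ᵐ x ∂μ, |Y i x + T x| ≤ _) ∧ ∫ x, (Y i x + T x) ∂μ = 0 ∧ ∫ x, (Y i x + T x) ^ 2 ∂μ = _ ∧ ∫ x, (Y i x + T x) ^ 4 ∂μ ≤ _
    replace m1 : ∫ x, T x ∂μ = 0 := m1
    replace m2 : ∫ x, T x ^ 2 ∂μ = s.card * v := m2
    replace m4 : ∫ x, T x ^ 4 ∂μ ≤ 3 * (s.card : ℝ) ^ 2 := m4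
    have y4 : ∫ x, Y i x ^ 4 ∂μ ≤ 1 := by
      calc _ ≤ ∫ x, (1:ℝ) ∂μ := by
            refine integral_mono_ae (by simpa using ig 0 4) (integrable_const _) ?_
            filter_upwards [hb i] with x hx
            have := pow_le_one₀ (n := 4) (abs_nonneg _) hx
            rwa [Even.pow_abs (by decide)] at this
        _ = 1 := by simp
    refine ⟨?_, ?_, ?_, ?_⟩
    · filter_upwards [b, hb i] with x hx hx'
      push_cast
      have := abs_add_le (Y i x) (T x)
      linarith
    · rw [integral_add (by simpa using ig 0 1) (by simpa using ig 1 0), h1, m1]; simp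
    · have e : ∀ x, (Y i x + T x)^2 = T x ^ 0 * Y i x ^ 2 + 2 * (T x ^ 1 * Y i x ^ 1) + T x ^ 2 * Y i x ^ 0 := fun x => by ring
      simp only [e]
      rw [integral_add ((ig 0 2).fun_add ((ig 1 1).const_mul _)) (ig 2 0), integral_add (ig 0 2) ((ig 1 1).const_mul _), integral_const_mul, pr, pr, pr]
      simp [m1, m2, h2, h1]; ring
    · have e : ∀ x, (Y i x + T x)^4 = T x ^ 0 * Y i x ^ 4 + 4 * (T x ^ 1 * Y i x ^ 3) + 6 * (T x ^ 2 * Y i x ^ 2) + 4 * (T x ^ 3 * Y i x ^ 1) + T x ^ 4 * Y i x ^ 0 := fun x => by ring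
      simp only [e]
      rw [integral_add ((((ig 0 4).fun_add ((ig 1 3).const_mul _)).fun_add ((ig 2 2).const_mul _)).fun_add ((ig 3 1).const_mul _)) (ig 4 0),
        integral_add (((ig 0 4).fun_add ((ig 1 3).const_mul _)).fun_add ((ig 2 2).const_mul _)) ((ig 3 1).const_mul _),
        integral_add ((ig 0 4).fun_add ((ig 1 3).const_mul _)) ((ig 2 2).const_mul _),
        integral_add (ig 0 4) ((ig 1 3).const_mul _), integral_const_mul, integral_const_mul, integral_const_mul, pr, pr, pr, pr, pr]
      simp [m1, m2, h2, h1]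
      have hc : (0:ℝ) ≤ s.card := by positivity
      have : v * v ≤ 1 := by nlinarith
      nlinarith

lemma analytic {Ω : Type*} [MeasurableSpace Ω] {μ : Measure Ω} [IsProbabilityMeasure μ]
    (D : Ω → ℝ) (hD : Measurable D) (hD0 : ∀ x, 0 ≤ D x) (B : ℝ) (hB : ∀ᵐ x ∂μ, D x ≤ B)
    (m w K : ℝ) (hm : 1 ≤ m) (hw : 0 ≤ w) (hK : 0 ≤ K)
    (h1 : ∫ x, (D x ^ 2 - m ^ 2) ∂μ = 0) (h2 : ∫ x, (D x ^ 2 - m ^ 2) ^ 2 ∂μ = 4 * m ^ 2 * w)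
    (h4 : ∫ x, (D x ^ 2 - m ^ 2) ^ 4 ∂μ ≤ K * m ^ 4) :
    |∫ x, (D x - ∫ y, D y ∂μ) ^ 2 ∂μ - w| ≤ (2 * w + K + 4 * w ^ 2) / m := by
  have m0 : 0 < m := by linarith
  have ib : ∀ f : ℝ → ℝ, Continuous f → Integrable (fun x => f (D x)) μ := by
    intro f hf
    obtain ⟨C, hC⟩ := (isCompact_Icc (a := (0:ℝ)) (b := B)).exists_bound_of_continuousOn hf.continuousOn
    refine bint C (hf.measurable.comp hD) ?_
    filter_upwards [hB] with x hx
    exact hC _ ⟨hD0 x, hx⟩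
  have ip : ∀ k : ℕ, Integrable (fun x => (D x - m) ^ k) μ := fun k => ib (fun t => (t - m)^k) (by fun_prop)
  have i1 : Integrable (fun x => (D x - m)) μ := by simpa using ip 1
  have iD : Integrable D μ := ib (fun t => t) (by fun_prop)
  set e := ∫ x, (D x - m) ∂μ with he
  set a := ∫ x, (D x - m)^2 ∂μ with ha
  set c := ∫ x, (D x - m)^3 ∂μ with hc
  set b := ∫ x, (D x - m)^4 ∂μ with hb
  have a0 : 0 ≤ a := integral_nonneg fun x => by positivity
  have b0 : 0 ≤ b := integral_nonneg fun x => by positivity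
  have E1 : 2 * m * e + a = 0 := by
    rw [← h1, he, ha, ← integral_const_mul, ← integral_add (i1.const_mul _) (ip 2)]
    congr 1; ext x; ring
  have E2 : 4 * m^2 * a + 4 * m * c + b = 4 * m^2 * w := by
    rw [← h2, ha, hb, hc, ← integral_const_mul, ← integral_const_mul, ← integral_add ((ip 2).const_mul _) ((ip 3).const_mul _), ← integral_add (((ip 2).const_mul _).fun_add ((ip 3).const_mul _)) (ip 4)]
    congr 1; ext x; ring
  have A : a ≤ 4 * w := by
    have : m^2 * a ≤ 4 * m^2 * w := by
      rw [← h2, ha, ← integral_const_mul]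
      refine integral_mono ((ip 2).const_mul _) (ib (fun t => (t^2-m^2)^2) (by fun_prop)) fun x => ?_
      have := hD0 x
      have h : m^2 ≤ (D x + m)^2 := by gcongr; linarith
      calc m^2 * (D x - m)^2 ≤ (D x + m)^2 * (D x - m)^2 := by gcongr
        _ = _ := by ring
    have : m^2 * a ≤ m^2 * (4 * w) := by linarith
    exact le_of_mul_le_mul_left this (by positivity)
  have Bb : b ≤ K := by
    have : m^4 * b ≤ K * m^4 := by
      refine le_trans ?_ h4
      rw [hb, ← integral_const_mul]
      refine integral_mono ((ip 4).const_mul _) (ib (fun t => (t^2-m^2)^4) (by fun_prop)) fun x => ?_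
      have := hD0 x
      have h : m^4 ≤ (D x + m)^4 := by gcongr; linarith
      calc m^4 * (D x - m)^4 ≤ (D x + m)^4 * (D x - m)^4 := by gcongr
        _ = _ := by ring
    have : m^4 * b ≤ m^4 * K := by linarith
    exact le_of_mul_le_mul_left this (by positivity)
  have C1 : 2 * c ≤ a + b := by
    rw [ha, hb, hc, ← integral_const_mul, ← integral_add (ip 2) (ip 4)]
    refine integral_mono ((ip 3).const_mul _) ((ip 2).add (ip 4)) fun x => ?_
    nlinarith [sq_nonneg ((D x - m)^2 - (D x - m))]
  have C2 : (-2) * c ≤ a + b := by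
    rw [ha, hb, hc, ← integral_const_mul, ← integral_add (ip 2) (ip 4)]
    refine integral_mono ((ip 3).const_mul _) ((ip 2).add (ip 4)) fun x => ?_
    nlinarith [sq_nonneg ((D x - m)^2 + (D x - m))]
  have V : ∫ x, (D x - ∫ y, D y ∂μ) ^ 2 ∂μ = a - e^2 := by
    have hh : ∫ y, D y ∂μ = e + m := by
      rw [he, integral_sub iD (integrable_const _)]; simp
    have : ∀ x, (D x - (e + m))^2 = (D x - m)^2 - 2 * e * (D x - m) + e^2 := fun x => by ring
    rw [hh]
    simp only [this]
    rw [integral_add (f := fun x => (D x - m)^2 - 2 * e * (D x - m)) ((ip 2).sub (i1.const_mul _)) (integrable_const _), integral_sub (ip 2) (i1.const_mul _), integral_const_mul, ← he, ← ha]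
    simp; ring
  rw [V]
  have e' : e = - a / (2 * m) := by field_simp; linarith
  have w' : w - a = c / m + b / (4 * m^2) := by field_simp; linarith
  have s1 : |c / m| ≤ ((4 * w + K)/2) / m := by
    rw [abs_div, abs_of_pos m0]; gcongr
    rw [abs_le]; constructor <;> linarith
  have mm : m ≤ m^2 := by nlinarith
  have s2 : b / (4 * m^2) ≤ (K / 4) / m := by
    rw [div_div]; gcongr
  have s2' : 0 ≤ b / (4 * m^2) := by positivity
  have s3 : e^2 ≤ (4 * w^2) / m := by
    rw [e', div_pow]
    calc (-a)^2/(2*m)^2 = (a^2/4)/m^2 := by field_simp; norm_num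
      _ ≤ ((4*w)^2/4)/m := by gcongr
      _ = _ := by ring
  have s3' := sq_nonneg e
  have tot : (2 * w + K + 4 * w ^ 2) / m = ((4 * w + K)/2) / m + (K/4)/m + (4*w^2)/m + (K/4)/m := by ring
  have : 0 ≤ (K/4)/m := by positivity
  rw [tot]
  rw [abs_le] at s1 ⊢
  constructor <;> linarith [s1.1, s1.2]

noncomputable def DD (d : ℕ) (x : Fin d → ℝ × ℝ) : ℝ := dist (WithLp.toLp 2 fun i => (x i).1 : EuclideanSpace ℝ (Fin d)) (WithLp.toLp 2 fun i => (x i).2)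

lemma DD_sq (d : ℕ) (x : Fin d → ℝ × ℝ) : DD d x ^ 2 - d / 6 = ∑ i, yy (x i) := by
  unfold DD yy
  rw [EuclideanSpace.dist_eq, Real.sq_sqrt (by positivity)]
  simp [Real.dist_eq]
  ring

lemma DD_meas (d : ℕ) : Measurable (DD d) := by
  unfold DD
  fun_prop

lemma bound (d : ℕ) (hd : 6 ≤ d) :
    |∫ x, (DD d x - ∫ y, DD d y ∂(Measure.pi fun _ : Fin d => lam.prod lam)) ^ 2 ∂(Measure.pi fun _ : Fin d => lam.prod lam) - 7/120| ≤ (2 * (7/120) + 108 + 4 * (7/120) ^ 2) / √(d/6) := by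
  have hd' : (6:ℝ) ≤ d := by exact_mod_cast hd
  have sm : √((d:ℝ)/6)^2 = d/6 := Real.sq_sqrt (by positivity)
  have mp := measurePreserving_eval (fun _ : Fin d => lam.prod lam)
  have im : ∀ (i : Fin d) (f : ℝ × ℝ → ℝ), Continuous f → ∫ x, f (x i) ∂(Measure.pi fun _ : Fin d => lam.prod lam) = ∫ x, f x ∂(lam.prod lam) := by
    intro i f hf
    have := integral_map (μ := Measure.pi fun _ : Fin d => lam.prod lam) (mp i).measurable.aemeasurable (f := f) hf.aestronglyMeasurable
    rw [(mp i).map_eq] at this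
    exact this.symm
  obtain ⟨b, m1, m2, m4⟩ := moments (μ := Measure.pi fun _ : Fin d => lam.prod lam) (fun i x => yy (x i))
    (iIndepFun_pi (fun i => yy_cont.measurable.aemeasurable))
    (fun i => yy_cont.measurable.comp (measurable_pi_apply i))
    (fun i => (mp i).quasiMeasurePreserving.ae yy_bd)
    (fun i => by rw [im i yy yy_cont, yy_mean]) (7/180) (by norm_num) (by norm_num)
    (fun i => by rw [im i (fun x => yy x ^ 2) (yy_cont.pow 2), yy_var]) Finset.univ
  simp only [← DD_sq, Finset.card_univ, Fintype.card_fin] at b m1 m2 m4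
  refine analytic (DD d) (DD_meas d) (fun x => dist_nonneg) (2 * d) ?_ _ _ _ ?_ (by norm_num) (by norm_num) ?_ ?_ ?_
  · filter_upwards [b] with x hx
    rw [abs_le] at hx
    have : 0 ≤ DD d x := dist_nonneg
    nlinarith
  · rw [Real.one_le_sqrt]; linarith
  · rw [sm]; exact m1
  · rw [sm, m2]; ring
  · rw [sm, show √((d:ℝ)/6)^4 = (√((d:ℝ)/6)^2)^2 by ring, sm]
    refine m4.trans (le_of_eq ?_); ring

lemma law {Ω : Type*} [MeasurableSpace Ω] {μ : Measure Ω} [IsProbabilityMeasure μ] (d : ℕ)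
    (P Q : Ω → EuclideanSpace ℝ (Fin d)) (hPQ : IndepFun P Q μ)
    (hP : Measure.map P μ = unifCube d) (hQ : Measure.map Q μ = unifCube d) (f : ℝ → ℝ) (hf : Continuous f) :
    ∫ ω, f (dist (P ω) (Q ω)) ∂μ = ∫ x, f (DD d x) ∂(Measure.pi fun _ : Fin d => lam.prod lam) := by
  have tm : Measurable (WithLp.toLp 2 : (Fin d → ℝ) → EuclideanSpace ℝ (Fin d)) := by fun_prop
  have ne : unifCube d ≠ 0 := by
    rw [unif_eq]
    have := Measure.isProbabilityMeasure_map (μ := Measure.pi (fun _ : Fin d => lam)) tm.aemeasurable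
    exact IsProbabilityMeasure.ne_zero _
  have aP : AEMeasurable P μ := by
    by_contra h; rw [Measure.map_of_not_aemeasurable h] at hP; exact ne hP.symm
  have aQ : AEMeasurable Q μ := by
    by_contra h; rw [Measure.map_of_not_aemeasurable h] at hQ; exact ne hQ.symm
  have key := (indepFun_iff_map_prod_eq_prod_map_map aP aQ).1 hPQ
  have arr := measurePreserving_arrowProdEquivProdArrow ℝ ℝ (Fin d) (fun _ => lam) (fun _ => lam)
  rw [hP, hQ, unif_eq, Measure.map_prod_map _ _ tm tm, ← arr.map_eq, Measure.map_map (tm.prodMap tm) arr.measurable] at key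
  have gc : Continuous (fun z : EuclideanSpace ℝ (Fin d) × EuclideanSpace ℝ (Fin d) => f (dist z.1 z.2)) := by fun_prop
  have l := integral_map (aP.prodMk aQ) (f := fun z => f (dist z.1 z.2)) gc.aestronglyMeasurable
  rw [key, integral_map ((tm.prodMap tm).comp arr.measurable).aemeasurable gc.aestronglyMeasurable] at l
  exact l.symm

/-- For each `d`, let `P^(d)`, `Q^(d)` be independent points uniformly
distributed in `[0,1]^d`.  Then `Var[‖P^(d) - Q^(d)‖₂] → (7/180)/(4·(1/6)) = 7/120`
as `d → ∞`. -/
theorem tendsto_variance_dist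
    {Ω : Type*} [MeasureSpace Ω] [IsProbabilityMeasure (ℙ : Measure Ω)]
    (P Q : (d : ℕ) → Ω → EuclideanSpace ℝ (Fin d))
    (hPQ : ∀ d, IndepFun (P d) (Q d) ℙ)
    (hP : ∀ d, Measure.map (P d) ℙ = unifCube d)
    (hQ : ∀ d, Measure.map (Q d) ℙ = unifCube d) :
    Tendsto (fun d : ℕ =>
        ∫ ω, (dist (P d ω) (Q d ω) - ∫ ω', dist (P d ω') (Q d ω') ∂ℙ) ^ 2 ∂ℙ)
      atTop (nhds (7 / 120)) := by
  rw [tendsto_iff_norm_sub_tendsto_zero]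
  have lim : Tendsto (fun d : ℕ => (2 * (7/120) + 108 + 4 * (7/120) ^ 2) / √((d:ℝ)/6)) atTop (nhds 0) := by
    refine Tendsto.div_atTop tendsto_const_nhds ?_
    exact Real.tendsto_sqrt_atTop.comp (tendsto_natCast_atTop_atTop.atTop_div_const (by norm_num))
  refine squeeze_zero' (Eventually.of_forall fun d => norm_nonneg _) ?_ lim
  filter_upwards [eventually_ge_atTop 6] with d hd
  have h1 := law d (P d) (Q d) (hPQ d) (hP d) (hQ d) (fun t => t) (by fun_prop)
  rw [h1, law d (P d) (Q d) (hPQ d) (hP d) (hQ d) (fun t => (t - ∫ x, DD d x ∂(Measure.pi fun _ : Fin d => lam.prod lam))^2) (by fun_prop)]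
  exact bound d hd
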